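/- The equation λ·sin ω = −sin(λω) with ω = 9π/8, which simplifies to sin(9πλ/8) = sin(π/8)·λ, has a real solution λ in the interval [0.80076, 0.80078]. -/

import Mathlib

open Real in
/-- Angle tripling turns the cubic Taylor bound for `sin` into a sharper one on `[0, 1]`. -/
theorem abs_sin_three_mul_sub_le {x : ℝ} (h0 : 0 ≤ x) (h1 : x ≤ 1 / 4) :
    |sin (3 * x) - (3 * (x - x ^ 3 / 6) - 4 * (x - x ^ 3 / 6) ^ 3)| ≤ 3 * (x ^ 5 / 100) := by
  have hb := sin_bound (x := x) (by rw [abs_of_nonneg h0]; linarith)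
  rw [abs_of_nonneg h0] at hb
  have hs0 : 0 ≤ sin x := sin_nonneg_of_nonneg_of_le_pi h0 (by linarith [pi_gt_three])
  have hs1 : sin x ≤ 1 / 4 := (sin_le h0).trans h1
  have ht0 : 0 ≤ x - x ^ 3 / 6 := by nlinarith [mul_nonneg h0 h0]
  have ht1 : x - x ^ 3 / 6 ≤ 1 / 4 := by linarith [pow_nonneg h0 3]
  rw [sin_three_mul]
  generalize x - x ^ 3 / 6 = t at *
  generalize sin x = s at *
  have hfactor : 3 * s - 4 * s ^ 3 - (3 * t - 4 * t ^ 3) =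
      (s - t) * (3 - 4 * (s ^ 2 + s * t + t ^ 2)) := by ring
  have hq : |3 - 4 * (s ^ 2 + s * t + t ^ 2)| ≤ 3 := by
    rw [abs_le]
    constructor <;> nlinarith [mul_nonneg hs0 ht0]
  rw [hfactor, abs_mul, mul_comm 3]
  exact mul_le_mul hb hq (abs_nonneg _) ((abs_nonneg _).trans hb)

open Real in
theorem sin_pi_div_eight_mem_Icc : sin (π / 8) ∈ Set.Icc (0.382683 : ℝ) 0.382684 := by
  have h1 : (1.4142135 : ℝ) ≤ √2 := le_sqrt_of_sq_le (by norm_num)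
  have h2 : √2 ≤ (1.4142136 : ℝ) := sqrt_le_iff.mpr (by norm_num)
  have h3 : (0.765366 : ℝ) ≤ √(2 - √2) := le_sqrt_of_sq_le (by norm_num at *; linarith)
  have h4 : √(2 - √2) ≤ (0.765368 : ℝ) :=
    sqrt_le_iff.mpr ⟨by norm_num, by norm_num at *; linarith⟩
  rw [sin_pi_div_eight]
  constructor <;> norm_num at * <;> linarith

open Real in
theorem sin_pi_div_eight_mul_lt_sin : sin (π / 8) * 0.80076 < sin (9 * π * 0.80076 / 8) := by
  have hl := pi_gt_d6
  have hu := pi_lt_d6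
  have hm : sin (3 * 0.103824) ≤ sin (9 * π * 0.80076 / 8) := by
    rw [← sin_pi_sub (9 * π * 0.80076 / 8)]
    apply sin_le_sin_of_le_of_le_pi_div_two <;> norm_num at * <;> linarith
  have hb := (abs_le.mp (abs_sin_three_mul_sub_le (x := 0.103824)
    (by norm_num) (by norm_num))).1
  have h8 := sin_pi_div_eight_mem_Icc.2
  norm_num at *
  linarith

open Real in
theorem sin_lt_sin_pi_div_eight_mul : sin (9 * π * 0.80078 / 8) < sin (π / 8) * 0.80078 := by
  have hl := pi_gt_d6
  have hu := pi_lt_d6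
  have hm : sin (9 * π * 0.80078 / 8) ≤ sin (3 * 0.103801) := by
    rw [← sin_pi_sub (9 * π * 0.80078 / 8)]
    apply sin_le_sin_of_le_of_le_pi_div_two <;> norm_num at * <;> linarith
  have hb := (abs_le.mp (abs_sin_three_mul_sub_le (x := 0.103801)
    (by norm_num) (by norm_num))).2
  have h8 := sin_pi_div_eight_mem_Icc.1
  norm_num at *
  linarith

/-- The equation `λ sin ω = −sin(λω)` with `ω = 9π/8`, which simplifies to
`sin(9πλ/8) = sin(π/8) λ`, has a real solution `λ ∈ [0.80076, 0.80078]`. -/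
theorem singular_exponent_nine_pi_div_eight :
    ∃ lam : ℝ, lam ∈ Set.Icc (0.80076 : ℝ) 0.80078 ∧
      lam * Real.sin (9 * Real.pi / 8) = -Real.sin (lam * (9 * Real.pi / 8)) ∧
      Real.sin (9 * Real.pi * lam / 8) = Real.sin (Real.pi / 8) * lam := by
  have hcont : ContinuousOn
      (fun x : ℝ => Real.sin (9 * Real.pi * x / 8) - Real.sin (Real.pi / 8) * x)
      (Set.Icc 0.80076 0.80078) := by fun_prop
  obtain ⟨x, hx, h⟩ := intermediate_value_Icc' (by norm_num) hcont
    ⟨(sub_neg.mpr sin_lt_sin_pi_div_eight_mul).le, (sub_pos.mpr sin_pi_div_eight_mul_lt_sin).le⟩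
  have h' := sub_eq_zero.mp h
  refine ⟨x, hx, ?_, h'⟩
  have hs : Real.sin (9 * Real.pi / 8) = -Real.sin (Real.pi / 8) := by
    rw [← Real.sin_add_pi]
    ring_nf
  rw [hs, show x * (9 * Real.pi / 8) = 9 * Real.pi * x / 8 by ring, h']
  ring
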